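/- Let n ≥ 1, W = ℝ × ℝⁿ × ℝⁿ × ℝⁿ with points w = (t,q,v,p), let L : ℝ × ℝⁿ × ℝⁿ → ℝ be a C¹ time-dependent Lagrangian, set E(t,q,v,p) := L(t,q,v) − p·v, and let Ω^L be the 2-form on W with Ω^L_w(X,Y) := dE_w(X)·dt(Y) − dE_w(Y)·dt(X) + Σᵢ(dpᵢ(X)·dqⁱ(Y) − dpᵢ(Y)·dqⁱ(X)), i.e. Ω^L = d(L − pᵢvⁱ)∧dt + Σᵢ dpᵢ∧dqⁱ. Then for any point w = (t,q,v,p) and any vectors a, b, c ∈ ℝⁿ, the vector Z = (1, a, b, c) ∈ ℝ × ℝⁿ × ℝⁿ × ℝⁿ satisfies Ω^L_w(Z, Y) = 0 for all Y ∈ ℝ × ℝⁿ × ℝⁿ × ℝⁿ if and only if a = v, p = ∂L/∂v(t,q,v), and c = ∂L/∂q(t,q,v) (with b arbitrary). In particular the contraction equation forces the Legendre relation p = ∂L/∂v as a zero-form constraint and reproduces the Euler–Lagrange relations q̇ = v, ṗ = ∂L/∂q along integral curves. -/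

import Mathlib

open Finset in
/-- `E(t,q,v,p) = L(t,q,v) − p·v` on `W = ℝ × ℝⁿ × ℝⁿ × ℝⁿ`. -/
noncomputable def Eext {n : ℕ} (L : ℝ × (Fin n → ℝ) × (Fin n → ℝ) → ℝ) :
    ℝ × (Fin n → ℝ) × (Fin n → ℝ) × (Fin n → ℝ) → ℝ :=
  fun w => L (w.1, w.2.1, w.2.2.1) - ∑ i, w.2.2.2 i * w.2.2.1 i

open Finset in
/-- The presymplectic 2-form `Ω^L = d(L − pᵢvⁱ)∧dt + Σᵢ dpᵢ∧dqⁱ` on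
`W = ℝ × ℝⁿ × ℝⁿ × ℝⁿ`, evaluated at `w` on tangent vectors `X`, `Y`:
`Ω^L_w(X,Y) = dE_w(X)·dt(Y) − dE_w(Y)·dt(X) + Σᵢ (dpᵢ(X)·dqⁱ(Y) − dpᵢ(Y)·dqⁱ(X))`. -/
noncomputable def OmegaL {n : ℕ} (L : ℝ × (Fin n → ℝ) × (Fin n → ℝ) → ℝ)
    (w X Y : ℝ × (Fin n → ℝ) × (Fin n → ℝ) × (Fin n → ℝ)) : ℝ :=
  fderiv ℝ (Eext L) w X * Y.1 - fderiv ℝ (Eext L) w Y * X.1 +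
    ∑ i, (X.2.2.2 i * Y.2.1 i - Y.2.2.2 i * X.2.1 i)

/-- The partial derivative vector `∂L/∂q (t,q,v) ∈ ℝⁿ`. -/
noncomputable def dLdq {n : ℕ} (L : ℝ × (Fin n → ℝ) × (Fin n → ℝ) → ℝ)
    (t : ℝ) (q v : Fin n → ℝ) : Fin n → ℝ :=
  fun i => fderiv ℝ L (t, q, v) (0, Pi.single i 1, 0)

/-- The partial derivative vector `∂L/∂v (t,q,v) ∈ ℝⁿ`. -/
noncomputable def dLdv {n : ℕ} (L : ℝ × (Fin n → ℝ) × (Fin n → ℝ) → ℝ)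
    (t : ℝ) (q v : Fin n → ℝ) : Fin n → ℝ :=
  fun i => fderiv ℝ L (t, q, v) (0, 0, Pi.single i 1)

theorem fderiv_Eext_aux {n : ℕ} (L : ℝ × (Fin n → ℝ) × (Fin n → ℝ) → ℝ)
    (hL : ContDiff ℝ 1 L) (t : ℝ) (q v p : Fin n → ℝ)
    (s : ℝ) (x y z : Fin n → ℝ) :
    fderiv ℝ (Eext L) (t, q, v, p) (s, x, y, z) =
      fderiv ℝ L (t, q, v) (s, x, y) - ∑ i, (p i * y i + z i * v i) := by
  let W := ℝ × (Fin n → ℝ) × (Fin n → ℝ) × (Fin n → ℝ)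
  let P1 : W →L[ℝ] ℝ := ContinuousLinearMap.fst ℝ _ _
  let R1 : W →L[ℝ] (Fin n → ℝ) × (Fin n → ℝ) × (Fin n → ℝ) := ContinuousLinearMap.snd ℝ _ _
  let P2 : W →L[ℝ] (Fin n → ℝ) := (ContinuousLinearMap.fst ℝ _ _).comp R1
  let R2 : W →L[ℝ] (Fin n → ℝ) × (Fin n → ℝ) := (ContinuousLinearMap.snd ℝ _ _).comp R1
  let P3 : W →L[ℝ] (Fin n → ℝ) := (ContinuousLinearMap.fst ℝ _ _).comp R2
  let P4 : W →L[ℝ] (Fin n → ℝ) := (ContinuousLinearMap.snd ℝ _ _).comp R2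
  let A : W →L[ℝ] ℝ × (Fin n → ℝ) × (Fin n → ℝ) := P1.prod (P2.prod P3)
  have hd : HasFDerivAt L (fderiv ℝ L (t, q, v)) (A (t, q, v, p)) :=
    (hL.differentiable (by simp) (t, q, v)).hasFDerivAt
  have h1 := hd.comp (t, q, v, p) A.hasFDerivAt
  have h2 : ∀ i ∈ (Finset.univ : Finset (Fin n)), HasFDerivAt
      (fun w : W => ((ContinuousLinearMap.proj i).comp P4 : W →L[ℝ] ℝ) w *
        ((ContinuousLinearMap.proj i).comp P3 : W →L[ℝ] ℝ) w) _ (t, q, v, p) := fun i _ =>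
    ((ContinuousLinearMap.proj i).comp P4 : W →L[ℝ] ℝ).hasFDerivAt.mul
      ((ContinuousLinearMap.proj i).comp P3 : W →L[ℝ] ℝ).hasFDerivAt
  have h3 := h1.sub (HasFDerivAt.fun_sum h2)
  have h4 : HasFDerivAt (Eext L) _ (t, q, v, p) := h3
  rw [h4.fderiv]
  simp [A, P1, P2, P3, P4, R1, R2]
  refine Finset.sum_congr rfl fun i _ => ?_
  change p i * y i + v i * z i = _
  ring

theorem fderiv_L_aux {n : ℕ} (L : ℝ × (Fin n → ℝ) × (Fin n → ℝ) → ℝ)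
    (t : ℝ) (q v : Fin n → ℝ) (s : ℝ) (x y : Fin n → ℝ) :
    fderiv ℝ L (t, q, v) (s, x, y) = s * fderiv ℝ L (t, q, v) (1, 0, 0) +
      ∑ i, x i * dLdq L t q v i + ∑ i, y i * dLdv L t q v i := by
  have h : ((s, x, y) : ℝ × (Fin n → ℝ) × (Fin n → ℝ)) = s • (1, 0, 0) +
      ∑ i, x i • ((0, Pi.single i 1, 0) : ℝ × (Fin n → ℝ) × (Fin n → ℝ)) +
      ∑ i, y i • ((0, 0, Pi.single i 1) : ℝ × (Fin n → ℝ) × (Fin n → ℝ)) := by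
    ext j <;> simp [Prod.fst_sum, Prod.snd_sum, Finset.sum_apply, Pi.single_apply]
  conv_lhs => rw [h]
  simp only [map_add, map_sum, map_smul, smul_eq_mul, dLdq, dLdv]

/-- For any point `w = (t,q,v,p)` and vectors `a, b, c ∈ ℝⁿ`, the vector
`Z = (1, a, b, c)` satisfies `Ω^L_w(Z, Y) = 0` for all `Y` if and only if
`a = v`, `p = ∂L/∂v(t,q,v)` and `c = ∂L/∂q(t,q,v)` (with `b` arbitrary). -/
theorem stmt6 {n : ℕ} (hn : 1 ≤ n) (L : ℝ × (Fin n → ℝ) × (Fin n → ℝ) → ℝ)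
    (hL : ContDiff ℝ 1 L) (t : ℝ) (q v p a b c : Fin n → ℝ) :
    (∀ Y : ℝ × (Fin n → ℝ) × (Fin n → ℝ) × (Fin n → ℝ),
        OmegaL L (t, q, v, p) (1, a, b, c) Y = 0) ↔
      a = v ∧ p = dLdv L t q v ∧ c = dLdq L t q v := by
  obtain ⟨T, hT⟩ : ∃ T : ℝ, ∀ (s : ℝ) (x y : Fin n → ℝ), fderiv ℝ L (t, q, v) (s, x, y) =
      s * T + ∑ i, x i * dLdq L t q v i + ∑ i, y i * dLdv L t q v i :=
    ⟨_, fderiv_L_aux L t q v⟩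
  constructor
  · intro h
    refine ⟨?_, ?_, ?_⟩ <;> ext i
    · have := h (0, 0, 0, Pi.single i 1)
      simp [OmegaL, fderiv_Eext_aux L hL, hT, Pi.single_apply] at this
      linarith
    · have := h (0, 0, Pi.single i 1, 0)
      simp [OmegaL, fderiv_Eext_aux L hL, hT, Pi.single_apply] at this
      linarith
    · have := h (0, Pi.single i 1, 0, 0)
      simp [OmegaL, fderiv_Eext_aux L hL, hT, Pi.single_apply] at this
      linarith
  · rintro ⟨rfl, rfl, rfl⟩ ⟨s, x, y, z⟩
    simp only [OmegaL, fderiv_Eext_aux L hL, hT, Finset.sum_add_distrib,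
      Finset.sum_sub_distrib, mul_comm (dLdv L t q a _), mul_comm (dLdq L t q a _)]
    ring
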